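/- arXiv:2507.01353 — 2 statements merged into one kernel-verified Lean document; each statement's English description precedes it below -/
import Mathlib

section
/- Let W be a real-valued random variable and let a ≤ b and c ≤ d be real numbers with a ≤ c and b ≤ d. Then for every s ∈ ℝ, P[{W ≥ s} ∩ {W ∈ [a,b]}] · P[W ∈ [c,d]] ≤ P[{W ≥ s} ∩ {W ∈ [c,d]}] · P[W ∈ [a,b]]; that is, the conditional distribution of W given W ∈ [c,d] stochastically dominates the conditional distribution of W given W ∈ [a,b]. -/
open MeasureTheory

/-- **Stochastic domination between conditionings on nested-upward intervals.**
Let `W` be a real-valued random variable, and let `a ≤ b`, `c ≤ d` with `a ≤ c` and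
`b ≤ d`. Then for every `s : ℝ`, in cross-multiplied form (so that no positivity
assumptions on the conditioning events are needed),
`P[{W ≥ s} ∩ {W ∈ [a,b]}] * P[W ∈ [c,d]] ≤ P[{W ≥ s} ∩ {W ∈ [c,d]}] * P[W ∈ [a,b]]`;
that is, the law of `W` conditioned on `W ∈ [c,d]` stochastically dominates the law of
`W` conditioned on `W ∈ [a,b]`. -/
theorem conditional_stochastic_domination
    {Ω : Type*} [MeasurableSpace Ω] (μ : Measure Ω) [IsProbabilityMeasure μ]
    (W : Ω → ℝ) (hW : Measurable W)
    (a b c d : ℝ) (hab : a ≤ b) (hcd : c ≤ d) (hac : a ≤ c) (hbd : b ≤ d)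
    (s : ℝ) :
    μ ({ω | s ≤ W ω} ∩ {ω | W ω ∈ Set.Icc a b}) * μ {ω | W ω ∈ Set.Icc c d} ≤
    μ ({ω | s ≤ W ω} ∩ {ω | W ω ∈ Set.Icc c d}) * μ {ω | W ω ∈ Set.Icc a b} := by
  have hS : MeasurableSet {ω | s ≤ W ω} := measurableSet_le measurable_const hW
  have h1 := measure_inter_add_sdiff (μ := μ) {ω | W ω ∈ Set.Icc a b} hS
  have h2 := measure_inter_add_sdiff (μ := μ) {ω | W ω ∈ Set.Icc c d} hS
  rw [← h1, ← h2, Set.inter_comm {ω | s ≤ W ω}, Set.inter_comm {ω | s ≤ W ω}, mul_add, mul_add,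
    mul_comm (μ ({ω | W ω ∈ Set.Icc c d} ∩ {ω | s ≤ W ω}))
      (μ ({ω | W ω ∈ Set.Icc a b} ∩ {ω | s ≤ W ω}))]
  refine add_le_add le_rfl ?_
  rcases le_or_gt s c with hsc | hsc
  · have : {ω | W ω ∈ Set.Icc c d} \ {ω | s ≤ W ω} = ∅ := by
      ext ω
      simp only [Set.mem_sdiff, Set.mem_ofPred_eq, Set.mem_Icc, Set.mem_empty_iff_false, iff_false]
      rintro ⟨⟨h, _⟩, h'⟩
      exact h' (hsc.trans h)
    rw [this, measure_empty]; simp only [mul_zero, zero_mul, zero_le]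
  rcases lt_or_ge b s with hsb | hsb
  · have : {ω | W ω ∈ Set.Icc a b} ∩ {ω | s ≤ W ω} = ∅ := by
      ext ω
      simp only [Set.mem_inter_iff, Set.mem_ofPred_eq, Set.mem_Icc, Set.mem_empty_iff_false,
        iff_false]
      rintro ⟨⟨_, h⟩, h'⟩
      linarith
    rw [this, measure_empty]; simp only [mul_zero, zero_mul, zero_le]
  refine mul_le_mul' (measure_mono ?_) (measure_mono ?_)
  · rintro ω ⟨⟨_, h⟩, h'⟩
    exact ⟨⟨hsc.le.trans h', h.trans hbd⟩, h'⟩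
  · rintro ω ⟨⟨h, _⟩, h'⟩
    exact ⟨⟨hac.trans h, (not_le.mp h').le.trans hsb⟩, h'⟩
end

section
/- Let Y_1, Y_2 be independent standard normal random variables and set Z_1 = 2Y_1 − Y_2, Z_2 = Y_1 + 2Y_2, Z_3 = Y_1, and Z̄ = (Z_1 + Z_2 + Z_3)/3. Fix 0 < ε < 1/3 and let C be the event {Z_3 ∈ [0, ε]}. Then P[{Z̄ ≥ 1/3} ∩ {Z_1 ≥ 1} ∩ C] = 0, while P[{Z̄ ≥ 1/3} ∩ C] > 0 and P[{Z_1 ≥ 1} ∩ C] > 0. In particular, P[{Z̄ ≥ 1/3} ∩ {Z_1 ≥ 1} ∩ C] · P[C] < P[{Z̄ ≥ 1/3} ∩ C] · P[{Z_1 ≥ 1} ∩ C], so Z̄ and Z_1 are not positively associated conditional on C, even though all pairwise covariances of Z_1, Z_2, Z_3 are nonnegative (so condition (P) holds). -/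
open MeasureTheory ProbabilityTheory

/-- **Condition (N) cannot be dropped from the conditional association theorem.**
Let `Y₁, Y₂` be independent standard normals, `Z₁ = 2Y₁ - Y₂`, `Z₂ = Y₁ + 2Y₂`,
`Z₃ = Y₁`, `Z̄ = (Z₁ + Z₂ + Z₃)/3` (a mean-zero jointly normal family with all
pairwise covariances nonnegative, so condition (P) holds). Fix `0 < ε < 1/3` and
let `C = {Z₃ ∈ [0, ε]}`. Then `P[{Z̄ ≥ 1/3} ∩ {Z₁ ≥ 1} ∩ C] = 0` while
`P[{Z̄ ≥ 1/3} ∩ C] > 0` and `P[{Z₁ ≥ 1} ∩ C] > 0`; in particular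
`P[{Z̄ ≥ 1/3} ∩ {Z₁ ≥ 1} ∩ C] * P[C] < P[{Z̄ ≥ 1/3} ∩ C] * P[{Z₁ ≥ 1} ∩ C]`,
so `Z̄` and `Z₁` are not positively associated given `C`. -/
theorem not_conditionally_associated
    {Ω : Type*} [MeasurableSpace Ω] (μ : Measure Ω) [IsProbabilityMeasure μ]
    (Y₁ Y₂ : Ω → ℝ) (h₁ : Measurable Y₁) (h₂ : Measurable Y₂)
    (hindep : IndepFun Y₁ Y₂ μ)
    (hl₁ : Measure.map Y₁ μ = gaussianReal 0 1)
    (hl₂ : Measure.map Y₂ μ = gaussianReal 0 1)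
    (Z₁ Z₂ Z₃ Zbar : Ω → ℝ)
    (hZ₁ : Z₁ = fun ω => 2 * Y₁ ω - Y₂ ω)
    (hZ₂ : Z₂ = fun ω => Y₁ ω + 2 * Y₂ ω)
    (hZ₃ : Z₃ = fun ω => Y₁ ω)
    (hZbar : Zbar = fun ω => (Z₁ ω + Z₂ ω + Z₃ ω) / 3)
    (ε : ℝ) (hε₀ : 0 < ε) (hε : ε < 1 / 3) :
    μ ({ω | 1 / 3 ≤ Zbar ω} ∩ {ω | 1 ≤ Z₁ ω} ∩ {ω | Z₃ ω ∈ Set.Icc 0 ε}) = 0 ∧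
    0 < μ ({ω | 1 / 3 ≤ Zbar ω} ∩ {ω | Z₃ ω ∈ Set.Icc 0 ε}) ∧
    0 < μ ({ω | 1 ≤ Z₁ ω} ∩ {ω | Z₃ ω ∈ Set.Icc 0 ε}) ∧
    μ ({ω | 1 / 3 ≤ Zbar ω} ∩ {ω | 1 ≤ Z₁ ω} ∩ {ω | Z₃ ω ∈ Set.Icc 0 ε}) *
        μ {ω | Z₃ ω ∈ Set.Icc 0 ε} <
      μ ({ω | 1 / 3 ≤ Zbar ω} ∩ {ω | Z₃ ω ∈ Set.Icc 0 ε}) *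
        μ ({ω | 1 ≤ Z₁ ω} ∩ {ω | Z₃ ω ∈ Set.Icc 0 ε}) := by
  have hpos : ∀ s : Set ℝ, volume s ≠ 0 → gaussianReal 0 1 s ≠ 0 := fun s hs h =>
    hs (gaussianReal_absolutelyContinuous' 0 one_ne_zero h)
  have key : ∀ t : Set ℝ, MeasurableSet t → volume t ≠ 0 →
      0 < μ (Y₁ ⁻¹' (Set.Icc 0 ε) ∩ Y₂ ⁻¹' t) := by
    intro t ht hvt
    rw [hindep.measure_inter_preimage_eq_mul _ _ measurableSet_Icc ht,
      ← Measure.map_apply h₁ measurableSet_Icc, ← Measure.map_apply h₂ ht, hl₁, hl₂]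
    refine pos_iff_ne_zero.2 (mul_ne_zero (hpos _ ?_) (hpos _ hvt))
    simp [hε₀]
  have hA : μ ({ω | 1 / 3 ≤ Zbar ω} ∩ {ω | 1 ≤ Z₁ ω} ∩ {ω | Z₃ ω ∈ Set.Icc 0 ε}) = 0 := by
    convert measure_empty (μ := μ)
    ext ω
    simp only [hZbar, hZ₁, hZ₂, hZ₃, Set.mem_inter_iff, Set.mem_setOf_eq, Set.mem_Icc,
      Set.mem_empty_iff_false, iff_false]
    rintro ⟨⟨a, b⟩, c, d⟩
    linarith
  have hB : 0 < μ ({ω | 1 / 3 ≤ Zbar ω} ∩ {ω | Z₃ ω ∈ Set.Icc 0 ε}) := by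
    refine (key (Set.Ici 1) measurableSet_Ici (by simp)).trans_le (measure_mono ?_)
    rintro ω ⟨⟨a, b⟩, c⟩
    simp only [Set.mem_preimage, Set.mem_Ici] at c
    simp only [hZbar, hZ₁, hZ₂, hZ₃, Set.mem_inter_iff, Set.mem_setOf_eq, Set.mem_Icc]
    exact ⟨by linarith, a, b⟩
  have hC : 0 < μ ({ω | 1 ≤ Z₁ ω} ∩ {ω | Z₃ ω ∈ Set.Icc 0 ε}) := by
    refine (key (Set.Iic (-1)) measurableSet_Iic (by simp)).trans_le (measure_mono ?_)
    rintro ω ⟨⟨a, b⟩, c⟩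
    simp only [Set.mem_preimage, Set.mem_Iic] at c
    simp only [hZ₁, hZ₃, Set.mem_inter_iff, Set.mem_setOf_eq, Set.mem_Icc]
    exact ⟨by linarith, a, b⟩
  refine ⟨hA, hB, hC, ?_⟩
  rw [hA, zero_mul]
  exact pos_iff_ne_zero.2 (mul_ne_zero hB.ne' hC.ne')
end
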